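/- Let n = 3. There is a constant C such that for every f : ℝ³ → ℂ⁴ with all components radial, ‖e^{it|D|}|D|^{−1}𝒟 f‖_{L²_t L^∞_x} ≤ C‖f‖_{Ḣ¹}, where |D|^{−1}𝒟 is the Fourier multiplier operator with matrix symbol (α·ξ)/|ξ|. -/

import Mathlib

noncomputable section

open MeasureTheory Real Complex Filter Matrix
open scoped FourierTransform ENNReal NNReal

attribute [local instance] Matrix.normedAddCommGroup

/-- Euclidean space `ℝ³`. -/
abbrev R3 : Type := EuclideanSpace ℝ (Fin 3)

/-- Spinors: elements of `ℂ⁴`. -/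
abbrev Spinor : Type := Fin 4 → ℂ

/-- The Pauli matrices. -/
def pauli : Fin 3 → Matrix (Fin 2) (Fin 2) ℂ
  | 0 => !![0, 1; 1, 0]
  | 1 => !![0, -Complex.I; Complex.I, 0]
  | 2 => !![1, 0; 0, -1]

/-- The Dirac matrices `αₖ = [[0,σₖ],[σₖ,0]]` in 2×2 block form. -/
def diracAlpha (k : Fin 3) : Matrix (Fin 4) (Fin 4) ℂ :=
  (Matrix.reindex finSumFinEquiv finSumFinEquiv
    (Matrix.fromBlocks 0 (pauli k) (pauli k) 0) : Matrix (Fin 4) (Fin 4) ℂ)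

/-- The Dirac matrix `β = [[I₂,0],[0,−I₂]]`. -/
def diracBeta : Matrix (Fin 4) (Fin 4) ℂ :=
  (Matrix.reindex finSumFinEquiv finSumFinEquiv
    (Matrix.fromBlocks (1 : Matrix (Fin 2) (Fin 2) ℂ) 0 0 (-1 : Matrix (Fin 2) (Fin 2) ℂ)) : Matrix (Fin 4) (Fin 4) ℂ)

/-- The matrix `γ₅ = [[0,I₂],[I₂,0]]`. -/
def gamma5 : Matrix (Fin 4) (Fin 4) ℂ :=
  (Matrix.reindex finSumFinEquiv finSumFinEquiv
    (Matrix.fromBlocks (0 : Matrix (Fin 2) (Fin 2) ℂ) 1 1 (0 : Matrix (Fin 2) (Fin 2) ℂ)) : Matrix (Fin 4) (Fin 4) ℂ)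

/-- `α·a = a₁α₁ + a₂α₂ + a₃α₃` for a real vector `a`. -/
def alphaD (a : Fin 3 → ℝ) : Matrix (Fin 4) (Fin 4) ℂ :=
  ∑ k, (a k : ℂ) • diracAlpha k

/-- The partial derivative `∂ₖ` of a spinor field. -/
def pd (k : Fin 3) (u : R3 → Spinor) (x : R3) : Spinor :=
  fderiv ℝ u x (EuclideanSpace.single k 1)

/-- The free Dirac operator `𝒟 = −i Σₖ αₖ ∂ₖ`. -/
def diracOp (u : R3 → Spinor) (x : R3) : Spinor :=
  (-Complex.I) • ∑ k, (diracAlpha k).mulVec (pd k u x)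

/-- The symbol `cos(t|ξ|)I₄ + i sin(t|ξ|)(α·ξ)/|ξ|` of the free Dirac propagator. -/
def diracSymb (t : ℝ) (ξ : R3) : Matrix (Fin 4) (Fin 4) ℂ :=
  (Real.cos (t * ‖ξ‖) : ℂ) • 1 +
    (Complex.I * (Real.sin (t * ‖ξ‖) : ℂ) / (‖ξ‖ : ℂ)) • alphaD (fun k => ξ k)

/-- The free Dirac propagator `e^{it𝒟}`, as the Fourier multiplier with matrix symbol
`cos(t|ξ|)I₄ + i sin(t|ξ|)(α·ξ)/|ξ|`. -/
def diracProp (t : ℝ) (f : R3 → Spinor) : R3 → Spinor :=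
  𝓕⁻ fun ξ => (diracSymb t ξ).mulVec (𝓕 f ξ)

/-- The homogeneous Sobolev norm `‖f‖_{Ḣˢ} = ‖ |ξ|ˢ f̂(ξ) ‖_{L²}`. -/
def hSob (s : ℝ) (f : R3 → Spinor) : ℝ≥0∞ :=
  eLpNorm (fun ξ : R3 => ‖ξ‖ ^ s • 𝓕 f ξ) 2 volume

/-- The mixed norm `‖u‖_{L²_t L^∞_x}`. -/
def L2Linf (u : ℝ → R3 → Spinor) : ℝ≥0∞ :=
  (∫⁻ t : ℝ, (eLpNorm (u t) ⊤ volume) ^ 2) ^ (1/2 : ℝ)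

/-- The mixed norm `‖u‖_{L²_t L²_x}`. -/
def L2L2 (u : ℝ → R3 → Spinor) : ℝ≥0∞ :=
  (∫⁻ t : ℝ, (eLpNorm (u t) 2 volume) ^ 2) ^ (1/2 : ℝ)

/-- A function on `ℝ³` is radial if it depends only on `|x|`. -/
def IsRadial {E : Type*} (f : R3 → E) : Prop :=
  ∀ x y : R3, ‖x‖ = ‖y‖ → f x = f y

/-- The class `𝓗̇¹`: `f = f₁ + 𝒟f₂` with `f₁ ∈ Ḣ¹`, `f₂ ∈ Ḣ²`, componentwise radial. -/
def Hclass (f : R3 → Spinor) : Prop :=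
  ∃ f₁ f₂ : R3 → Spinor,
    (∀ j, IsRadial fun x => f₁ x j) ∧ (∀ j, IsRadial fun x => f₂ x j) ∧
    hSob 1 f₁ < ⊤ ∧ hSob 2 f₂ < ⊤ ∧ f = f₁ + fun x => diracOp f₂ x

/-- The potential `V(x) = V₁(|x|)I₄ + iβ(α·x̂)V₂(|x|)`. -/
def potential (V₁ V₂ : ℝ → ℝ) (x : R3) : Matrix (Fin 4) (Fin 4) ℂ :=
  (V₁ ‖x‖ : ℂ) • 1 +
    (Complex.I * (V₂ ‖x‖ : ℂ)) • (diracBeta * alphaD fun k => ‖x‖⁻¹ * x k)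

/-- The size assumption `|V(x)| ≤ δ/(|x|^{1/2}|log|x||^{σ/2} + |x|^σ)`. -/
def VBound (σ δ : ℝ) (V : R3 → Matrix (Fin 4) (Fin 4) ℂ) : Prop :=
  ∀ x : R3, x ≠ 0 →
    ‖V x‖ ≤ δ / (‖x‖ ^ (1/2 : ℝ) * |Real.log ‖x‖| ^ (σ/2) + ‖x‖ ^ σ)


/-- The operator `e^{it|D|} |D|^{-1} 𝒟`: Fourier multiplier with matrix symbol
`e^{it|ξ|} (α·ξ)/|ξ|`. -/
def hwDirac (t : ℝ) (f : R3 → Spinor) : R3 → Spinor :=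
  𝓕⁻ fun ξ => Complex.exp (Complex.I * (t : ℂ) * (‖ξ‖ : ℂ)) •
    ((‖ξ‖⁻¹ • alphaD fun k => ξ k).mulVec (𝓕 f ξ))


/-- The maximal function over dyadic radii, `sup_k ∫_{-1}^1 φ(t + 2ᵏ μ) dμ`. -/
def dyadicMaximal (φ : ℝ → ℝ≥0∞) (t : ℝ) : ℝ≥0∞ :=
  ⨆ k : ℤ, ∫⁻ μ in Set.Icc (-1 : ℝ) 1, φ (t + 2 ^ k * μ)

lemma measurable_dyadicMaximal {φ : ℝ → ℝ≥0∞} (hφ : Measurable φ) :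
    Measurable (dyadicMaximal φ) := by
  refine Measurable.iSup fun k => ?_
  have h : Measurable fun p : ℝ × ℝ => φ (p.1 + 2 ^ k * p.2) := by fun_prop
  exact h.lintegral_prod_right'

lemma ofReal_mul_lintegral_comp_add_mul (φ : ℝ → ℝ≥0∞) (t : ℝ) {R : ℝ} (hR : 0 < R) :
    ENNReal.ofReal R * ∫⁻ μ in Set.Icc (-1 : ℝ) 1, φ (t + R * μ) =
      ∫⁻ s in Metric.closedBall t R, φ s := by
  have himg : (fun μ : ℝ => t + R * μ) '' Set.Icc (-1) 1 = Metric.closedBall t R := by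
    rw [Real.closedBall_eq_Icc]
    ext s
    simp only [Set.mem_image, Set.mem_Icc]
    constructor
    · rintro ⟨μ, ⟨h1, h2⟩, rfl⟩
      constructor <;> nlinarith
    · rintro ⟨h1, h2⟩
      refine ⟨(s - t) / R, ⟨?_, ?_⟩, ?_⟩
      · rw [le_div_iff₀ hR]; linarith
      · rw [div_le_iff₀ hR]; linarith
      · field_simp; ring
  have h := lintegral_image_eq_lintegral_abs_deriv_mul (f := fun μ : ℝ => t + R * μ)
    (f' := fun _ => R) (s := Set.Icc (-1) 1) measurableSet_Icc
    (fun x _ => by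
      simpa using (((hasDerivAt_id x).const_mul R).const_add t).hasDerivWithinAt)
    (fun x _ y _ hxy => by
      have : R * x = R * y := by simpa using hxy
      exact mul_left_cancel₀ hR.ne' this) φ
  rw [himg] at h
  rw [h, lintegral_const_mul' _ _ ENNReal.ofReal_ne_top, abs_of_pos hR]

lemma lintegral_comp_add_mul_le_dyadicMaximal (φ : ℝ → ℝ≥0∞) (t : ℝ) {R : ℝ} (hR : 0 < R) :
    ∫⁻ μ in Set.Icc (-1 : ℝ) 1, φ (t + R * μ) ≤ 2 * dyadicMaximal φ t := by
  obtain ⟨n, hn1, hn2⟩ := exists_mem_Ioc_zpow hR (one_lt_two : (1 : ℝ) < 2)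
  have h2 : (0 : ℝ) < 2 ^ (n + 1) := by positivity
  have hle : (2 : ℝ) ^ (n + 1) ≤ R * 2 := by
    rw [zpow_add_one₀ two_ne_zero]; linarith
  have hR0 : ENNReal.ofReal R ≠ 0 := by simpa using hR
  rw [← ENNReal.mul_le_mul_iff_right hR0 ENNReal.ofReal_ne_top,
    ofReal_mul_lintegral_comp_add_mul φ t hR]
  calc ∫⁻ s in Metric.closedBall t R, φ s
      ≤ ∫⁻ s in Metric.closedBall t (2 ^ (n + 1)), φ s :=
        lintegral_mono_set (Metric.closedBall_subset_closedBall hn2)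
    _ = ENNReal.ofReal (2 ^ (n + 1)) * ∫⁻ μ in Set.Icc (-1 : ℝ) 1, φ (t + 2 ^ (n + 1) * μ) :=
        (ofReal_mul_lintegral_comp_add_mul φ t h2).symm
    _ ≤ ENNReal.ofReal (R * 2) * dyadicMaximal φ t := by
        gcongr
        exact le_iSup (fun k : ℤ => ∫⁻ μ in Set.Icc (-1 : ℝ) 1, φ (t + 2 ^ k * μ)) (n + 1)
    _ = ENNReal.ofReal R * (2 * dyadicMaximal φ t) := by
        rw [ENNReal.ofReal_mul hR.le, mul_assoc]; simp

/-- The weak type `(1,1)` bound for the maximal function. -/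
lemma mul_volume_lt_dyadicMaximal_le {φ : ℝ → ℝ≥0∞} (l : ℝ) (hl : 0 < l) :
    ENNReal.ofReal l * volume {t | ENNReal.ofReal l < dyadicMaximal φ t} ≤
      10 * ∫⁻ t, φ t := by
  by_cases hfin : ∫⁻ t, φ t = ⊤
  · simp [hfin]
  set I : Set (ℝ × ℤ) := {p | ENNReal.ofReal (l * 2 ^ p.2) ≤
    ∫⁻ s in Metric.closedBall p.1 (2 ^ p.2), φ s} with hI
  have hr : ∀ p ∈ I, (2 : ℝ) ^ p.2 ≤ (∫⁻ t, φ t).toReal / l := by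
    intro p hp
    rw [le_div_iff₀ hl, mul_comm]
    exact (ENNReal.ofReal_le_iff_le_toReal hfin).1 (le_trans hp (setLIntegral_le_lintegral _ _))
  obtain ⟨u, huI, hdisj, hcov⟩ := Vitali.exists_disjoint_subfamily_covering_enlargement_closedBall
    I (fun p => p.1) (fun p => (2 : ℝ) ^ p.2) _ hr 5 (by norm_num)
  have hucount : u.Countable := by
    refine hdisj.countable_of_nonempty_interior fun p _ => ?_
    refine ⟨p.1, Metric.ball_subset_interior_closedBall ?_⟩
    exact Metric.mem_ball_self (by positivity)
  have hsub : {t | ENNReal.ofReal l < dyadicMaximal φ t} ⊆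
      ⋃ p ∈ u, Metric.closedBall p.1 (5 * 2 ^ p.2) := by
    intro t ht
    obtain ⟨k, hk⟩ := lt_iSup_iff.1 (show ENNReal.ofReal l < dyadicMaximal φ t from ht)
    have hmem : (t, k) ∈ I := by
      have hp : (0 : ℝ) < 2 ^ k := by positivity
      simp only [hI, Set.mem_ofPred_eq]
      rw [← ofReal_mul_lintegral_comp_add_mul φ t hp, mul_comm l, ENNReal.ofReal_mul hp.le]
      gcongr
    obtain ⟨b, hb, hsubset⟩ := hcov _ hmem
    exact Set.mem_biUnion hb (hsubset (Metric.mem_closedBall_self (by positivity)))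
  calc ENNReal.ofReal l * volume {t | ENNReal.ofReal l < dyadicMaximal φ t}
      ≤ ENNReal.ofReal l * ∑' p : u, volume (Metric.closedBall p.1.1 (5 * (2 : ℝ) ^ p.1.2)) := by
        gcongr
        exact (measure_mono hsub).trans (measure_biUnion_le _ hucount _)
    _ = ∑' p : u, 10 * ENNReal.ofReal (l * 2 ^ p.1.2) := by
        rw [← ENNReal.tsum_mul_left]
        congr 1; ext p
        rw [Real.volume_closedBall, ← ENNReal.ofReal_mul hl.le,
          show (10 : ℝ≥0∞) = ENNReal.ofReal 10 by simp, ← ENNReal.ofReal_mul (by norm_num)]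
        congr 1; ring
    _ ≤ ∑' p : u, 10 * ∫⁻ s in Metric.closedBall p.1.1 (2 ^ p.1.2), φ s := by
        gcongr with p
        exact huI p.2
    _ = 10 * ∫⁻ s in ⋃ p ∈ u, Metric.closedBall p.1 (2 ^ p.2), φ s := by
        rw [ENNReal.tsum_mul_left,
          lintegral_biUnion hucount (fun p _ => Metric.isClosed_closedBall.measurableSet) hdisj]
    _ ≤ 10 * ∫⁻ t, φ t := by
        gcongr
        exact Measure.restrict_le_self

lemma dyadicMaximal_le_of_le_add {φ ψ : ℝ → ℝ≥0∞} {c : ℝ≥0∞} (h : ∀ t, φ t ≤ ψ t + c) (t : ℝ) :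
    dyadicMaximal φ t ≤ dyadicMaximal ψ t + 2 * c := by
  refine iSup_le fun k => ?_
  calc ∫⁻ μ in Set.Icc (-1 : ℝ) 1, φ (t + 2 ^ k * μ)
      ≤ ∫⁻ μ in Set.Icc (-1 : ℝ) 1, (ψ (t + 2 ^ k * μ) + c) := lintegral_mono fun μ => h _
    _ = (∫⁻ μ in Set.Icc (-1 : ℝ) 1, ψ (t + 2 ^ k * μ)) + 2 * c := by
        rw [lintegral_add_right _ measurable_const, setLIntegral_const, Real.volume_Icc, mul_comm c]
        norm_num
    _ ≤ _ := by
        gcongr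
        exact le_iSup (fun k : ℤ => ∫⁻ μ in Set.Icc (-1 : ℝ) 1, ψ (t + 2 ^ k * μ)) k

/-- The strong `L²` bound for the maximal function of a bounded function. -/
lemma lintegral_dyadicMaximal_sq_le {φ : ℝ → ℝ≥0∞} (hφ : Measurable φ) (B : ℝ≥0)
    (hB : ∀ t, φ t ≤ B) :
    ∫⁻ t, dyadicMaximal φ t ^ 2 ≤ 160 * ∫⁻ t, φ t ^ 2 := by
  have hfin : ∀ t, dyadicMaximal φ t ≠ ⊤ := fun t => by
    have h := dyadicMaximal_le_of_le_add (ψ := fun _ => 0) (c := B) (by simpa using hB) t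
    refine ne_top_of_le_ne_top ?_ h
    simp [dyadicMaximal, ENNReal.mul_eq_top]
  have hM := measurable_dyadicMaximal hφ
  have hlayer := lintegral_rpow_eq_lintegral_meas_lt_mul (μ := (volume : Measure ℝ))
    (f := fun t => (dyadicMaximal φ t).toReal) (ae_of_all _ fun _ => ENNReal.toReal_nonneg)
    hM.ennreal_toReal.aemeasurable (p := 2) two_pos
  have hlhs : ∀ t, ENNReal.ofReal ((dyadicMaximal φ t).toReal ^ (2 : ℝ)) =
      dyadicMaximal φ t ^ 2 := fun t => by
    rw [Real.rpow_two, ENNReal.ofReal_pow ENNReal.toReal_nonneg, ENNReal.ofReal_toReal (hfin t)]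
  simp only [hlhs] at hlayer
  rw [hlayer]
  have hpt : ∀ l ∈ Set.Ioi (0 : ℝ), volume {t | l < (dyadicMaximal φ t).toReal} *
      ENNReal.ofReal (l ^ ((2 : ℝ) - 1)) ≤
        20 * ∫⁻ t, {p : ℝ × ℝ | ENNReal.ofReal (p.1 / 4) < φ p.2}.indicator
          (fun p => φ p.2) (l, t) := by
    intro l hl
    have hl : 0 < l := hl
    set ψ : ℝ → ℝ≥0∞ := fun t => {p : ℝ × ℝ | ENNReal.ofReal (p.1 / 4) < φ p.2}.indicator
          (fun p => φ p.2) (l, t) with hψ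
    have hle : ∀ t, φ t ≤ ψ t + ENNReal.ofReal (l / 4) := fun t => by
      by_cases h : ENNReal.ofReal (l / 4) < φ t
      · simp [hψ, h]
      · simpa [hψ, h] using not_lt.1 h
    have hsub : {t | l < (dyadicMaximal φ t).toReal} ⊆
        {t | ENNReal.ofReal (l / 2) < dyadicMaximal ψ t} := by
      intro t ht
      have h1 : ENNReal.ofReal l < dyadicMaximal φ t :=
        (ENNReal.ofReal_lt_iff_lt_toReal hl.le (hfin t)).2 ht
      have h2 := h1.trans_le (dyadicMaximal_le_of_le_add hle t)
      have h3 : 2 * ENNReal.ofReal (l / 4) = ENNReal.ofReal (l / 2) := by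
        rw [show (2 : ℝ≥0∞) = ENNReal.ofReal 2 by simp, ← ENNReal.ofReal_mul (by norm_num)]
        congr 1; ring
      have h4 : ENNReal.ofReal l = ENNReal.ofReal (l / 2) + ENNReal.ofReal (l / 2) := by
        rw [← ENNReal.ofReal_add (by positivity) (by positivity)]; simp
      rw [h3, h4] at h2
      exact lt_of_add_lt_add_right h2
    have hw := mul_volume_lt_dyadicMaximal_le (φ := ψ) (l / 2) (by positivity)
    calc volume {t | l < (dyadicMaximal φ t).toReal} * ENNReal.ofReal (l ^ ((2 : ℝ) - 1))
        ≤ volume {t | ENNReal.ofReal (l / 2) < dyadicMaximal ψ t} *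
            (2 * ENNReal.ofReal (l / 2)) := by
          gcongr
          rw [show (2 : ℝ≥0∞) = ENNReal.ofReal 2 by simp, ← ENNReal.ofReal_mul (by norm_num)]
          apply ENNReal.ofReal_le_ofReal
          norm_num
          linarith
      _ = 2 * (ENNReal.ofReal (l / 2) *
            volume {t | ENNReal.ofReal (l / 2) < dyadicMaximal ψ t}) := by ring
      _ ≤ 2 * (10 * ∫⁻ t, ψ t) := by gcongr
      _ = 20 * ∫⁻ t, ψ t := by rw [← mul_assoc]; norm_num
  have hmeas : Measurable ({p : ℝ × ℝ | ENNReal.ofReal (p.1 / 4) < φ p.2}.indicator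
      (fun p => φ p.2)) :=
    (hφ.comp measurable_snd).indicator (measurableSet_lt (by fun_prop) (by fun_prop))
  calc ENNReal.ofReal 2 * ∫⁻ l in Set.Ioi (0 : ℝ), volume {t | l < (dyadicMaximal φ t).toReal} *
        ENNReal.ofReal (l ^ ((2 : ℝ) - 1))
      ≤ ENNReal.ofReal 2 * ∫⁻ l in Set.Ioi (0 : ℝ),
          20 * ∫⁻ t, {p : ℝ × ℝ | ENNReal.ofReal (p.1 / 4) < φ p.2}.indicator
            (fun p => φ p.2) (l, t) := by
        gcongr 1
        exact setLIntegral_mono' measurableSet_Ioi hpt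
    _ = 40 * ∫⁻ t, ∫⁻ l in Set.Ioi (0 : ℝ),
          {p : ℝ × ℝ | ENNReal.ofReal (p.1 / 4) < φ p.2}.indicator (fun p => φ p.2) (l, t) := by
        rw [lintegral_const_mul' _ _ (by norm_num), ← mul_assoc]
        congr 1
        · norm_num
        · exact lintegral_lintegral_swap (f := fun l t => {p : ℝ × ℝ | ENNReal.ofReal (p.1 / 4) <
            φ p.2}.indicator (fun p => φ p.2) (l, t)) hmeas.aemeasurable
    _ ≤ 40 * ∫⁻ t, 4 * φ t ^ 2 := by
        gcongr with t
        have hne : φ t ≠ ⊤ := ne_top_of_le_ne_top ENNReal.coe_ne_top (hB t)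
        calc ∫⁻ l in Set.Ioi (0 : ℝ), {p : ℝ × ℝ | ENNReal.ofReal (p.1 / 4) < φ p.2}.indicator
                (fun p => φ p.2) (l, t)
            ≤ ∫⁻ l in Set.Ioi (0 : ℝ), (Set.Ioo 0 (4 * (φ t).toReal)).indicator
                (fun _ => φ t) l := by
              refine setLIntegral_mono' measurableSet_Ioi fun l hl => ?_
              by_cases h : ENNReal.ofReal (l / 4) < φ t
              · have hl' : l ∈ Set.Ioo 0 (4 * (φ t).toReal) := by
                  have := (ENNReal.ofReal_lt_iff_lt_toReal
                    (div_nonneg (le_of_lt hl) (by norm_num)) hne).1 h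
                  exact ⟨hl, by linarith⟩
                simp [hl', h]
              · simp [h]
          _ ≤ ∫⁻ l, (Set.Ioo 0 (4 * (φ t).toReal)).indicator (fun _ => φ t) l :=
              setLIntegral_le_lintegral _ _
          _ = 4 * φ t ^ 2 := by
              rw [lintegral_indicator_const measurableSet_Ioo, Real.volume_Ioo, sub_zero,
                ENNReal.ofReal_mul (by norm_num), ENNReal.ofReal_toReal hne]
              simp; ring
    _ = 160 * ∫⁻ t, φ t ^ 2 := by
        rw [lintegral_const_mul' _ _ (by norm_num), ← mul_assoc]; norm_num

/-- The Plancherel theorem for the Fourier integral of an integrable, square integrable function. -/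
lemma eLpNorm_fourier_eq_of_integrable_of_memLp {h : ℝ → ℂ} (h1 : Integrable h)
    (h2 : MemLp h 2) : eLpNorm (𝓕 h) 2 = eLpNorm h 2 := by
  set F : Lp ℂ 2 (volume : Measure ℝ) := 𝓕 (h2.toLp h) with hF
  have hcont : Continuous (𝓕 h) := VectorFourier.fourierIntegral_continuous
    Real.continuous_fourierChar (by fun_prop) h1
  have hae : (F : ℝ → ℂ) =ᵐ[volume] 𝓕 h := by
    refine ae_eq_of_integral_contDiff_smul_eq
      ((Lp.memLp F).locallyIntegrable (by norm_num)) hcont.locallyIntegrable ?_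
    intro g g_smooth g_cpt
    have hg₁ : HasCompactSupport (Complex.ofRealCLM ∘ g) := g_cpt.comp_left rfl
    have hg₂ : ContDiff ℝ (⊤ : ℕ∞) (Complex.ofRealCLM ∘ g) := by fun_prop
    set G := hg₁.toSchwartzMap hg₂ with hG
    have hGg : ∀ x, G x = (g x : ℂ) := fun x => rfl
    calc ∫ x, g x • F x = ∫ x, G x • F x := by simp [hGg]
      _ = Lp.toTemperedDistribution F G := (Lp.toTemperedDistribution_apply F G).symm
      _ = Lp.toTemperedDistribution (h2.toLp h) (𝓕 G) := by
          rw [hF, ← Lp.fourier_toTemperedDistribution_eq, TemperedDistribution.fourier_apply]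
      _ = ∫ x, 𝓕 G x • h x := by
          rw [Lp.toTemperedDistribution_apply]
          refine integral_congr_ae ?_
          filter_upwards [h2.coeFn_toLp] with x hx
          rw [hx]
      _ = ∫ x, G x • 𝓕 h x := by
          have := VectorFourier.integral_fourierIntegral_smul_eq_flip (L := innerₗ ℝ)
            (μ := volume) (ν := volume) Real.continuous_fourierChar (by fun_prop)
            G.integrable h1
          rw [flip_innerₗ] at this
          exact this
      _ = ∫ x, g x • 𝓕 h x := by simp [hGg]
  rw [← eLpNorm_congr_ae hae, ← eLpNorm_congr_ae h2.coeFn_toLp]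
  have := Lp.norm_fourier_eq (h2.toLp h)
  rw [Lp.norm_def, Lp.norm_def, ENNReal.toReal_eq_toReal_iff' (Lp.eLpNorm_ne_top _)
    (Lp.eLpNorm_ne_top _)] at this
  exact this

lemma lintegral_fourierInv_sq_le {h : ℝ → ℂ} (h1 : Integrable h) :
    ∫⁻ s, ‖𝓕⁻ h s‖ₑ ^ 2 ≤ ∫⁻ s, ‖h s‖ₑ ^ 2 := by
  by_cases hfin : ∫⁻ s, ‖h s‖ₑ ^ 2 = ⊤
  · simp [hfin]
  have hsq : ∀ g : ℝ → ℂ, eLpNorm g 2 ^ 2 = ∫⁻ s, ‖g s‖ₑ ^ 2 := fun g => by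
    have := eLpNorm_nnreal_pow_eq_lintegral (μ := (volume : Measure ℝ)) (f := g) (p := 2)
      (by norm_num)
    simpa using this
  have h2 : MemLp h 2 := by
    refine ⟨h1.1, ?_⟩
    rw [← hsq h] at hfin
    exact lt_of_le_of_ne le_top fun h' => hfin (by rw [h']; simp)
  have hneg : ∫⁻ s, ‖𝓕⁻ h s‖ₑ ^ 2 = ∫⁻ s, ‖𝓕 h s‖ₑ ^ 2 := by
    simp only [Real.fourierInv_eq_fourier_neg]
    exact lintegral_neg_eq_self (fun s => ‖𝓕 h s‖ₑ ^ 2)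
  rw [hneg, ← hsq, ← hsq, eLpNorm_fourier_eq_of_integrable_of_memLp h1 h2]

/-- The radial measure `2πρ² dρ` on the half line. -/
def radialMeasure : Measure ℝ :=
  (volume.restrict (Set.Ioi 0)).withDensity fun ρ => ENNReal.ofReal (2 * π * ρ ^ 2)

lemma lintegral_radialMeasure {g : ℝ → ℝ≥0∞} (hg : Measurable g) :
    ∫⁻ ρ, g ρ ∂radialMeasure = ∫⁻ ρ in Set.Ioi 0, ENNReal.ofReal (2 * π * ρ ^ 2) * g ρ := by
  rw [radialMeasure, lintegral_withDensity_eq_lintegral_mul _ (by fun_prop) hg]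
  rfl

instance : SFinite radialMeasure := by unfold radialMeasure; infer_instance

lemma setLIntegral_sqrt_sq_add_sq (z : ℝ) (g : ℝ → ℝ≥0∞) :
    ∫⁻ p in Set.Ioi (0 : ℝ), ENNReal.ofReal p * g (√(z ^ 2 + p ^ 2)) =
      ∫⁻ ρ in Set.Ioi |z|, ENNReal.ofReal ρ * g ρ := by
  have himg : (fun p : ℝ => √(z ^ 2 + p ^ 2)) '' Set.Ioi 0 = Set.Ioi |z| := by
    ext ρ
    simp only [Set.mem_image, Set.mem_Ioi]
    constructor
    · rintro ⟨p, hp, rfl⟩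
      rw [← Real.sqrt_sq_eq_abs]
      exact Real.sqrt_lt_sqrt (sq_nonneg z) (by nlinarith)
    · intro h
      have h0 : 0 < ρ := (abs_nonneg z).trans_lt h
      have h1 : z ^ 2 < ρ ^ 2 := sq_lt_sq.2 (by rwa [abs_of_pos h0])
      refine ⟨√(ρ ^ 2 - z ^ 2), Real.sqrt_pos.2 (by linarith), ?_⟩
      rw [Real.sq_sqrt (by linarith), add_sub_cancel, Real.sqrt_sq h0.le]
  have hpos : ∀ p ∈ Set.Ioi (0 : ℝ), 0 < z ^ 2 + p ^ 2 := fun p hp => by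
    have : 0 < p := hp
    positivity
  have h := lintegral_image_eq_lintegral_abs_deriv_mul (f := fun p : ℝ => √(z ^ 2 + p ^ 2))
    (f' := fun p => p / √(z ^ 2 + p ^ 2)) (s := Set.Ioi 0) measurableSet_Ioi
    (fun p hp => by
      have h1 : HasDerivAt (fun p : ℝ => z ^ 2 + p ^ 2) (2 * p) p := by
        simpa using ((hasDerivAt_id p).pow 2).const_add (z ^ 2)
      have h2 := (h1.sqrt (hpos p hp).ne').hasDerivWithinAt (s := Set.Ioi 0)
      rwa [mul_div_mul_left _ _ two_ne_zero] at h2)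
    (fun p hp q hq hpq => by
      have h1 := (Real.sqrt_inj (hpos p hp).le (hpos q hq).le).1 hpq
      have h2 : p ^ 2 = q ^ 2 := by linarith
      exact (pow_left_inj₀ (le_of_lt hp) (le_of_lt hq) two_ne_zero).1 h2)
    (fun ρ => ENNReal.ofReal ρ * g ρ)
  rw [himg] at h
  rw [h]
  refine setLIntegral_congr_fun measurableSet_Ioi fun p hp => ?_
  have hp' : 0 < p := hp
  have hs : 0 < √(z ^ 2 + p ^ 2) := Real.sqrt_pos.2 (hpos p hp)
  rw [← mul_assoc, ← ENNReal.ofReal_mul (abs_nonneg _), abs_of_pos (by positivity),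
    div_mul_cancel₀ _ hs.ne']

lemma lintegral_comp_sqrt_sq_add_sq (z : ℝ) {g : ℝ → ℝ≥0∞} (hg : Measurable g) :
    ∫⁻ q : ℝ × ℝ, g (√(z ^ 2 + (q.1 ^ 2 + q.2 ^ 2))) =
      ∫⁻ ρ in Set.Ioi |z|, ENNReal.ofReal (2 * π * ρ) * g ρ := by
  rw [← lintegral_comp_polarCoord_symm]
  have hsq : ∀ p : ℝ × ℝ, (polarCoord.symm p).1 ^ 2 + (polarCoord.symm p).2 ^ 2 = p.1 ^ 2 := by
    intro p
    simp only [polarCoord_symm_apply]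
    nlinarith [Real.sin_sq_add_cos_sq p.2]
  simp only [hsq, polarCoord_target, smul_eq_mul]
  rw [Measure.volume_eq_prod, ← Measure.prod_restrict, lintegral_prod _ (by fun_prop)]
  simp only [lintegral_const, Measure.restrict_apply_univ, Real.volume_Ioo]
  rw [lintegral_mul_const _ (by fun_prop), setLIntegral_sqrt_sq_add_sq,
    ← lintegral_mul_const _ (by fun_prop)]
  refine setLIntegral_congr_fun measurableSet_Ioi fun ρ hρ => ?_
  rw [mul_right_comm, mul_comm (ENNReal.ofReal ρ), ← ENNReal.ofReal_mul (by linarith [Real.pi_pos])]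
  congr 2; ring

lemma setLIntegral_Ioo_comp_div {ρ : ℝ} (hρ : 0 < ρ) (g : ℝ → ℝ≥0∞) :
    ∫⁻ z in Set.Ioo (-ρ) ρ, g (z / ρ) = ENNReal.ofReal ρ * ∫⁻ μ in Set.Ioo (-1 : ℝ) 1, g μ := by
  have himg : (fun μ : ℝ => ρ * μ) '' Set.Ioo (-1) 1 = Set.Ioo (-ρ) ρ := by
    rw [Set.image_mul_left_Ioo hρ]; simp
  have h := lintegral_image_eq_lintegral_abs_deriv_mul (f := fun μ : ℝ => ρ * μ)
    (f' := fun _ => ρ) (s := Set.Ioo (-1) 1) measurableSet_Ioo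
    (fun x _ => by simpa using ((hasDerivAt_id x).const_mul ρ).hasDerivWithinAt)
    (fun x _ y _ hxy => mul_left_cancel₀ hρ.ne' hxy) (fun z => g (z / ρ))
  rw [himg] at h
  rw [h, lintegral_const_mul' _ _ ENNReal.ofReal_ne_top, abs_of_pos hρ]
  simp [mul_div_cancel_left₀ _ hρ.ne']

lemma lintegral_norm_coord {F : ℝ × ℝ → ℝ≥0∞} (hF : Measurable F) :
    ∫⁻ ξ : R3, F (‖ξ‖, ξ 0 / ‖ξ‖) =
      ∫⁻ ρ, (∫⁻ μ in Set.Ioo (-1 : ℝ) 1, F (ρ, μ)) ∂radialMeasure := by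
  have hmp : MeasurePreserving (fun ξ : R3 => (ξ 0, (ξ 1, ξ 2))) := by
    have h1 := PiLp.volume_preserving_ofLp (Fin 3)
    have h2 := volume_preserving_piFinSuccAbove (fun _ : Fin 3 => ℝ) 0
    have h3 := (MeasurePreserving.id (volume : Measure ℝ)).prod (volume_preserving_finTwoArrow ℝ)
    exact h3.comp (h2.comp h1)
  have hnorm : ∀ ξ : R3, ‖ξ‖ = √(ξ 0 ^ 2 + (ξ 1 ^ 2 + ξ 2 ^ 2)) := fun ξ => by
    rw [EuclideanSpace.norm_eq, Fin.sum_univ_three]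
    simp [add_assoc]
  have hmeas : Measurable fun p : ℝ × ℝ × ℝ =>
      F (√(p.1 ^ 2 + (p.2.1 ^ 2 + p.2.2 ^ 2)), p.1 / √(p.1 ^ 2 + (p.2.1 ^ 2 + p.2.2 ^ 2))) := by
    fun_prop
  have hmeas' : Measurable fun p : ℝ × ℝ =>
      (Set.Ioi |p.1|).indicator (fun ρ => ENNReal.ofReal (2 * π * ρ) * F (ρ, p.1 / ρ)) p.2 := by
    have : Measurable ({p : ℝ × ℝ | |p.1| < p.2}.indicator
      fun p => ENNReal.ofReal (2 * π * p.2) * F (p.2, p.1 / p.2)) :=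
      Measurable.indicator (by fun_prop) (measurableSet_lt (by fun_prop) (by fun_prop))
    exact this
  calc ∫⁻ ξ : R3, F (‖ξ‖, ξ 0 / ‖ξ‖)
      = ∫⁻ p : ℝ × ℝ × ℝ, F (√(p.1 ^ 2 + (p.2.1 ^ 2 + p.2.2 ^ 2)),
          p.1 / √(p.1 ^ 2 + (p.2.1 ^ 2 + p.2.2 ^ 2))) := by
        rw [← hmp.lintegral_comp hmeas]
        simp only [hnorm]
    _ = ∫⁻ z : ℝ, ∫⁻ ρ in Set.Ioi |z|, ENNReal.ofReal (2 * π * ρ) * F (ρ, z / ρ) := by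
        rw [Measure.volume_eq_prod, lintegral_prod _ hmeas.aemeasurable]
        refine lintegral_congr fun z => ?_
        exact lintegral_comp_sqrt_sq_add_sq z (g := fun ρ => F (ρ, z / ρ)) (by fun_prop)
    _ = ∫⁻ z : ℝ, ∫⁻ ρ, (Set.Ioi |z|).indicator
          (fun ρ => ENNReal.ofReal (2 * π * ρ) * F (ρ, z / ρ)) ρ := by
        simp only [lintegral_indicator measurableSet_Ioi]
    _ = ∫⁻ ρ, ∫⁻ z : ℝ, (Set.Ioi |z|).indicator
          (fun ρ => ENNReal.ofReal (2 * π * ρ) * F (ρ, z / ρ)) ρ :=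
        lintegral_lintegral_swap hmeas'.aemeasurable
    _ = ∫⁻ ρ, (Set.Ioi 0).indicator (fun ρ => ENNReal.ofReal (2 * π * ρ ^ 2) *
          ∫⁻ μ in Set.Ioo (-1 : ℝ) 1, F (ρ, μ)) ρ := by
        refine lintegral_congr fun ρ => ?_
        by_cases hρ : 0 < ρ
        · rw [Set.indicator_of_mem (Set.mem_Ioi.2 hρ)]
          calc ∫⁻ z : ℝ, (Set.Ioi |z|).indicator
                (fun ρ => ENNReal.ofReal (2 * π * ρ) * F (ρ, z / ρ)) ρ
              = ∫⁻ z in Set.Ioo (-ρ) ρ, ENNReal.ofReal (2 * π * ρ) * F (ρ, z / ρ) := by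
                rw [← lintegral_indicator measurableSet_Ioo]
                refine lintegral_congr fun z => ?_
                simp only [Set.indicator_apply, Set.mem_Ioi, Set.mem_Ioo, abs_lt]
            _ = _ := by
                rw [lintegral_const_mul' _ _ ENNReal.ofReal_ne_top,
                  setLIntegral_Ioo_comp_div hρ (fun μ => F (ρ, μ)), ← mul_assoc,
                  ← ENNReal.ofReal_mul (by positivity)]
                congr 2; ring
        · rw [Set.indicator_of_notMem (by simpa using hρ)]
          simp only [Set.indicator_apply, Set.mem_Ioi]
          have : ∀ z : ℝ, ¬ |z| < ρ := fun z h => hρ ((abs_nonneg z).trans_lt h)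
          simp [this]
    _ = _ := by
        rw [lintegral_indicator measurableSet_Ioi, lintegral_radialMeasure hF.lintegral_prod_right']

/-- The hat-box theorem of Archimedes: the norm and the cosine of the angle with a fixed
direction carry Lebesgue measure on `ℝ³` to the product of `2πρ² dρ` and Lebesgue measure on `(-1, 1)`. -/
lemma measurePreserving_norm_inner_div {e : R3} (he : ‖e‖ = 1) :
    MeasurePreserving (fun ξ : R3 => (‖ξ‖, inner ℝ e ξ / ‖ξ‖)) volume
      (radialMeasure.prod (volume.restrict (Set.Ioo (-1 : ℝ) 1))) := by
  have hm : Measurable fun ξ : R3 => ((‖ξ‖, ξ 0 / ‖ξ‖) : ℝ × ℝ) := by fun_prop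
  have h0 : MeasurePreserving (fun ξ : R3 => ((‖ξ‖, ξ 0 / ‖ξ‖) : ℝ × ℝ)) volume
      (radialMeasure.prod (volume.restrict (Set.Ioo (-1 : ℝ) 1))) := by
    refine ⟨hm, Measure.ext_of_lintegral _ fun F hF => ?_⟩
    rw [lintegral_map hF hm, lintegral_prod _ hF.aemeasurable, lintegral_norm_coord hF]
  set e0 : R3 := EuclideanSpace.single 0 1
  have hA := Submodule.reflection_sub (v := e) (w := e0) (by simp [he, e0])
  set A := (ℝ ∙ (e - e0))ᗮ.reflection
  have hcomp := h0.comp A.measurePreserving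
  have hfun : (fun ξ : R3 => ((‖ξ‖, inner ℝ e ξ / ‖ξ‖) : ℝ × ℝ)) =
      (fun ξ : R3 => ((‖ξ‖, ξ 0 / ‖ξ‖) : ℝ × ℝ)) ∘ A := by
    funext ξ
    have h1 : A ξ 0 = inner ℝ e0 (A ξ) := by simp [e0, EuclideanSpace.inner_single_left]
    simp only [Function.comp_apply, LinearIsometryEquiv.norm_map, h1]
    rw [← hA, A.inner_map_map]
  rw [hfun]
  exact hcomp

lemma diracAlpha_mulVec (k : Fin 3) (v : Spinor) :
    (diracAlpha k).mulVec v = (![![v 3, v 2, v 1, v 0],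
      ![-Complex.I * v 3, Complex.I * v 2, -Complex.I * v 1, Complex.I * v 0],
      ![v 2, -v 3, v 0, -v 1]] : Fin 3 → Spinor) k := by
  have h0 : diracAlpha 0 = !![0, 0, 0, 1; 0, 0, 1, 0; 0, 1, 0, 0; 1, 0, 0, 0] := by
    ext i j; fin_cases i <;> fin_cases j <;> rfl
  have h1 : diracAlpha 1 = !![0, 0, 0, -Complex.I; 0, 0, Complex.I, 0;
      0, -Complex.I, 0, 0; Complex.I, 0, 0, 0] := by
    ext i j; fin_cases i <;> fin_cases j <;> rfl
  have h2 : diracAlpha 2 = !![0, 0, 1, 0; 0, 0, 0, -1; 1, 0, 0, 0; 0, -1, 0, 0] := by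
    ext i j; fin_cases i <;> fin_cases j <;> rfl
  fin_cases k
  · simp only [Fin.zero_eta, h0]
    ext i; fin_cases i <;> simp [Matrix.mulVec, dotProduct, Fin.sum_univ_four]
  · simp only [Fin.mk_one, h1]
    ext i; fin_cases i <;> simp [Matrix.mulVec, dotProduct, Fin.sum_univ_four]
  · simp only [Fin.reduceFinMk, h2]
    ext i; fin_cases i <;> simp [Matrix.mulVec, dotProduct, Fin.sum_univ_four]

lemma norm_diracAlpha_mulVec_le (k : Fin 3) (v : Spinor) : ‖(diracAlpha k).mulVec v‖ ≤ ‖v‖ := by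
  rw [diracAlpha_mulVec, pi_norm_le_iff_of_nonneg (norm_nonneg v)]
  intro i
  fin_cases k <;> fin_cases i <;> simpa using norm_le_pi_norm v _

lemma alphaD_mulVec (a : Fin 3 → ℝ) (v : Spinor) :
    (alphaD a).mulVec v = ∑ k, (a k : ℂ) • (diracAlpha k).mulVec v := by
  simp [alphaD, Matrix.sum_mulVec, Matrix.smul_mulVec]

lemma norm_alphaD_mulVec_le (a : R3) (v : Spinor) :
    ‖(alphaD fun k => a k).mulVec v‖ ≤ 3 * ‖a‖ * ‖v‖ := by
  rw [alphaD_mulVec]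
  calc ‖∑ k, (a k : ℂ) • (diracAlpha k).mulVec v‖
      ≤ ∑ _k : Fin 3, ‖a‖ * ‖v‖ := by
        refine norm_sum_le_of_le _ fun k _ => ?_
        rw [norm_smul, Complex.norm_real]
        exact mul_le_mul (PiLp.norm_apply_le a k) (norm_diracAlpha_mulVec_le k v)
          (norm_nonneg _) (norm_nonneg _)
    _ = 3 * ‖a‖ * ‖v‖ := by simp; ring

lemma alphaD_mulVec_alphaD_mulVec (a : R3) (v : Spinor) :
    (alphaD fun k => a k).mulVec ((alphaD fun k => a k).mulVec v) = (‖a‖ ^ 2 : ℝ) • v := by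
  rw [EuclideanSpace.real_norm_sq_eq]
  simp only [alphaD_mulVec, diracAlpha_mulVec, Fin.sum_univ_three]
  ext i
  fin_cases i <;> simp <;> ring_nf <;> simp

lemma smul_alphaD (c : ℝ) (a : R3) :
    (c • alphaD fun k => a k) = alphaD fun k => (c • a) k := by
  simp only [alphaD, Finset.smul_sum]
  refine Finset.sum_congr rfl fun k _ => ?_
  ext i j
  simp [mul_assoc]

lemma continuous_fourier (f : R3 → Spinor) : Continuous (𝓕 f) := by
  by_cases hf : Integrable f
  · exact VectorFourier.fourierIntegral_continuous Real.continuous_fourierChar continuous_inner hf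
  · have : 𝓕 f = 0 := by
      funext ξ
      exact integral_undef fun h => hf ((VectorFourier.fourierIntegral_convergent_iff
        Real.continuous_fourierChar continuous_inner ξ).1 h)
    rw [this]
    exact continuous_const

lemma isRadial_fourier {f : R3 → Spinor} (hf : ∀ j, IsRadial fun x => f x j) :
    IsRadial (𝓕 f) := by
  intro ξ η h
  set A := (ℝ ∙ (ξ - η))ᗮ.reflection
  have hA : A ξ = η := Submodule.reflection_sub h
  have hfA : f ∘ A = f := by
    funext x; ext j
    exact hf j _ _ (A.norm_map x)
  rw [← hA, ← Real.fourier_comp_linearIsometry, hfA]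

/-- The radial profile of the Fourier transform. -/
def fourierProfile (f : R3 → Spinor) (ρ : ℝ) : Spinor := 𝓕 f (ρ • EuclideanSpace.single 0 1)

lemma continuous_fourierProfile (f : R3 → Spinor) : Continuous (fourierProfile f) :=
  (continuous_fourier f).comp (by fun_prop)

lemma fourier_eq_fourierProfile {f : R3 → Spinor} (hf : ∀ j, IsRadial fun x => f x j) (ξ : R3) :
    𝓕 f ξ = fourierProfile f ‖ξ‖ :=
  isRadial_fourier hf _ _ (by simp [norm_smul])

lemma lintegral_comp_norm {g : ℝ → ℝ≥0∞} (hg : Measurable g) :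
    ∫⁻ ξ : R3, g ‖ξ‖ = 2 * ∫⁻ ρ, g ρ ∂radialMeasure := by
  have h := (measurePreserving_norm_inner_div (e := EuclideanSpace.single 0 1)
    (by simp)).lintegral_comp (f := fun p => g p.1) (by fun_prop)
  rw [h, lintegral_prod _ (by fun_prop)]
  simp only [lintegral_const, Measure.restrict_apply_univ, Real.volume_Ioo]
  rw [lintegral_mul_const _ hg, mul_comm]
  norm_num

lemma integrable_fourierProfile {f : R3 → Spinor} (hf : ∀ j, IsRadial fun x => f x j)
    (hint : Integrable (𝓕 f)) : Integrable (fourierProfile f) radialMeasure := by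
  refine ⟨(continuous_fourierProfile f).aestronglyMeasurable, ?_⟩
  have h := hint.2
  rw [hasFiniteIntegral_iff_enorm] at h ⊢
  simp only [fourier_eq_fourierProfile hf] at h
  rw [lintegral_comp_norm (g := fun ρ => ‖fourierProfile f ρ‖ₑ)
    (continuous_fourierProfile f).enorm.measurable] at h
  exact lt_of_le_of_lt (le_mul_of_one_le_left' (by norm_num)) h

lemma integrable_fourier_of_integrable {f : R3 → Spinor} (t : ℝ) (x : R3)
    (h : Integrable fun ξ : R3 => 𝐞 (inner ℝ ξ x) • (Complex.exp (Complex.I * (t : ℂ) * (‖ξ‖ : ℂ)) •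
      ((‖ξ‖⁻¹ • alphaD fun k => ξ k).mulVec (𝓕 f ξ)))) : Integrable (𝓕 f) := by
  refine (h.norm.const_mul 3).mono' (continuous_fourier f).aestronglyMeasurable ?_
  filter_upwards [Measure.ae_ne volume (0 : R3)] with ξ hξ
  have hexp : ‖Complex.exp (Complex.I * (t : ℂ) * (‖ξ‖ : ℂ))‖ = 1 := by
    rw [show Complex.I * (t : ℂ) * (‖ξ‖ : ℂ) = ((t * ‖ξ‖ : ℝ) : ℂ) * Complex.I by push_cast; ring,
      Complex.norm_exp_ofReal_mul_I]
  have hunit : ‖‖ξ‖⁻¹ • ξ‖ = 1 := by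
    rw [norm_smul, norm_inv, norm_norm, inv_mul_cancel₀ (norm_ne_zero_iff.2 hξ)]
  rw [Circle.norm_smul, norm_smul, hexp, one_mul, smul_alphaD]
  have h1 := alphaD_mulVec_alphaD_mulVec (‖ξ‖⁻¹ • ξ) (𝓕 f ξ)
  have h2 := norm_alphaD_mulVec_le (‖ξ‖⁻¹ • ξ)
    ((alphaD fun k => (‖ξ‖⁻¹ • ξ) k).mulVec (𝓕 f ξ))
  rw [h1, hunit] at h2
  simpa using h2

/-- The one-dimensional profile `s ↦ ∫ e^{2πiρs} f̂(ρ) 2πρ² dρ` of the half-wave evolution. -/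
def waveProfile (f : R3 → Spinor) (s : ℝ) : Spinor :=
  ∫ ρ, 𝐞 (ρ * s) • fourierProfile f ρ ∂radialMeasure

lemma alphaD_mulVec_add_reflection {x : R3} (hx : x ≠ 0) (ξ : R3) (v : Spinor) :
    (alphaD fun k => ξ k).mulVec v + (alphaD fun k => (ℝ ∙ x).reflection ξ k).mulVec v =
      (2 : ℝ) • (alphaD fun k => (‖x‖⁻¹ • x) k).mulVec ((inner ℝ (‖x‖⁻¹ • x) ξ : ℝ) • v) := by
  have hx' : ‖x‖ ≠ 0 := norm_ne_zero_iff.2 hx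
  have h : ∀ k, ξ k + (ℝ ∙ x).reflection ξ k = 2 * (inner ℝ (‖x‖⁻¹ • x) ξ * (‖x‖⁻¹ • x) k) := by
    intro k
    rw [Submodule.reflection_singleton_apply]
    simp [real_inner_smul_left]
    field_simp
  simp only [alphaD_mulVec, ← Finset.sum_add_distrib, ← add_smul, Finset.smul_sum,
    Matrix.mulVec_smul]
  refine Finset.sum_congr rfl fun k _ => ?_
  rw [← Complex.ofReal_add, h k]
  ext i
  simp
  ring

lemma hwDirac_eq {f : R3 → Spinor} (hf : ∀ j, IsRadial fun x => f x j)
    (hint : Integrable (𝓕 f)) (t : ℝ) {x : R3} (hx : x ≠ 0) :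
    hwDirac t f x = (alphaD fun k => (‖x‖⁻¹ • x) k).mulVec
      (∫ μ in Set.Ioo (-1 : ℝ) 1, μ • waveProfile f (t / (2 * π) + ‖x‖ * μ)) := by
  have hx' : ‖x‖ ≠ 0 := norm_ne_zero_iff.2 hx
  set e : R3 := ‖x‖⁻¹ • x with he
  have hunit : ‖e‖ = 1 := by
    rw [he, norm_smul, norm_inv, norm_norm, inv_mul_cancel₀ hx']
  set E : R3 → Spinor := fun ξ => 𝐞 (inner ℝ ξ x) •
    (Complex.exp (Complex.I * (t : ℂ) * (‖ξ‖ : ℂ)) • (‖ξ‖⁻¹ • fourierProfile f ‖ξ‖)) with hE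
  set K : ℝ × ℝ → Spinor := fun p =>
    p.2 • (𝐞 (p.1 * (t / (2 * π) + ‖x‖ * p.2)) • fourierProfile f p.1) with hK
  have hKcont : Continuous K := by
    have := continuous_fourierProfile f
    have hchar := Real.continuous_fourierChar
    fun_prop
  have hmp := measurePreserving_norm_inner_div hunit
  have hKE : ∀ ξ : R3, K (‖ξ‖, inner ℝ e ξ / ‖ξ‖) = (inner ℝ e ξ : ℝ) • E ξ := by
    intro ξ
    rcases eq_or_ne ξ 0 with rfl | hξ
    · simp [hK, hE]
    have hξ' : ‖ξ‖ ≠ 0 := norm_ne_zero_iff.2 hξ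
    have h1 : inner ℝ ξ x = ‖x‖ * inner ℝ e ξ := by
      rw [he, real_inner_smul_left, real_inner_comm]
      field_simp
    have h2 : (𝐞 (‖ξ‖ * (t / (2 * π) + ‖x‖ * (inner ℝ e ξ / ‖ξ‖))) : ℂ) =
        𝐞 (inner ℝ ξ x) * Complex.exp (Complex.I * (t : ℂ) * (‖ξ‖ : ℂ)) := by
      rw [Real.fourierChar_apply, Real.fourierChar_apply, ← Complex.exp_add, h1]
      congr 1
      have hπ : (π : ℂ) ≠ 0 := by exact_mod_cast Real.pi_ne_zero
      have hξC : (‖ξ‖ : ℂ) ≠ 0 := by exact_mod_cast hξ'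
      push_cast
      field_simp
      ring
    simp only [hK, hE, Circle.smul_def]
    rw [h2]
    ext j
    simp only [Pi.smul_apply, smul_eq_mul, Complex.real_smul]
    push_cast
    ring
  have hKint' : Integrable fun ξ : R3 => K (‖ξ‖, inner ℝ e ξ / ‖ξ‖) := by
    refine hint.norm.mono' (hKcont.comp_aestronglyMeasurable hmp.measurable.aestronglyMeasurable)
      (ae_of_all _ fun ξ => ?_)
    simp only [hK, norm_smul, Circle.norm_smul, ← fourier_eq_fourierProfile hf]
    refine mul_le_of_le_one_left (norm_nonneg _) ?_
    rw [norm_div, norm_norm]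
    refine div_le_one_of_le₀ ?_ (norm_nonneg _)
    simpa [hunit] using norm_inner_le_norm (𝕜 := ℝ) e ξ
  have hKint : Integrable K (radialMeasure.prod (volume.restrict (Set.Ioo (-1 : ℝ) 1))) :=
    (hmp.integrable_comp hKcont.aestronglyMeasurable).1 hKint'
  have hI : ∀ ξ : R3, 𝐞 (inner ℝ ξ x) • (Complex.exp (Complex.I * (t : ℂ) * (‖ξ‖ : ℂ)) •
      ((‖ξ‖⁻¹ • alphaD fun k => ξ k).mulVec (𝓕 f ξ))) = (alphaD fun k => ξ k).mulVec (E ξ) := by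
    intro ξ
    simp only [hE, Circle.smul_def, Matrix.mulVec_smul, Matrix.smul_mulVec,
      fourier_eq_fourierProfile hf]
  set R := (ℝ ∙ x).reflection
  have hER : ∀ ξ, E (R ξ) = E ξ := by
    intro ξ
    have hRx : R x = x :=
      Submodule.reflection_mem_subspace_eq_self (Submodule.mem_span_singleton_self x)
    have : inner ℝ (R ξ) x = inner ℝ ξ x := by
      conv_lhs => rw [← hRx]
      exact R.inner_map_map ξ x
    simp only [hE, this, LinearIsometryEquiv.norm_map]
  have hIcomp : ∫ ξ, (alphaD fun k => ξ k).mulVec (E ξ) =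
      ∫ ξ, (alphaD fun k => R ξ k).mulVec (E ξ) := by
    rw [← R.measurePreserving.integral_comp R.toHomeomorph.measurableEmbedding]
    simp only [hER]
  have hEmeas : AEStronglyMeasurable E := by
    have := (continuous_fourierProfile f).measurable
    have hchar : Measurable fun s : ℝ => (𝐞 s : ℂ) :=
      (continuous_subtype_val.comp Real.continuous_fourierChar).measurable
    refine Measurable.aestronglyMeasurable ?_
    simp only [hE, Circle.smul_def]
    fun_prop
  have hnormE : ∀ ξ, ‖ξ‖ * ‖E ξ‖ ≤ ‖𝓕 f ξ‖ := by
    intro ξ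
    have hexp : ‖Complex.exp (Complex.I * (t : ℂ) * (‖ξ‖ : ℂ))‖ = 1 := by
      rw [show Complex.I * (t : ℂ) * (‖ξ‖ : ℂ) = ((t * ‖ξ‖ : ℝ) : ℂ) * Complex.I by
        push_cast; ring, Complex.norm_exp_ofReal_mul_I]
    simp only [hE, Circle.norm_smul, norm_smul, hexp, one_mul, norm_inv, norm_norm,
      fourier_eq_fourierProfile hf ξ, ← mul_assoc]
    exact mul_le_of_le_one_left (norm_nonneg _) mul_inv_le_one
  have hIint : ∀ A : R3 ≃ₗᵢ[ℝ] R3, Integrable fun ξ => (alphaD fun k => A ξ k).mulVec (E ξ) := by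
    intro A
    refine (hint.norm.const_mul 3).mono' ?_ (ae_of_all _ fun ξ => ?_)
    · simp only [alphaD_mulVec]
      refine Finset.aestronglyMeasurable_fun_sum _ fun k _ => ?_
      refine AEStronglyMeasurable.fun_smul ?_ ?_
      · have := A.continuous
        exact Continuous.aestronglyMeasurable (by fun_prop)
      · exact (Continuous.matrix_mulVec continuous_const continuous_id).comp_aestronglyMeasurable
          hEmeas
    · refine (norm_alphaD_mulVec_le (A ξ) (E ξ)).trans ?_
      rw [A.norm_map, mul_assoc]
      exact mul_le_mul_of_nonneg_left (hnormE ξ) (by norm_num)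
  have hpull : ∀ (M : Matrix (Fin 4) (Fin 4) ℂ) (g : R3 → Spinor), Integrable g →
      ∫ ξ, M.mulVec (g ξ) = M.mulVec (∫ ξ, g ξ) := fun M g hg =>
    (LinearMap.toContinuousLinearMap M.mulVecLin).integral_comp_comm hg
  have hsum : (2 : ℝ) • ∫ ξ, (alphaD fun k => ξ k).mulVec (E ξ) =
      (2 : ℝ) • (alphaD fun k => e k).mulVec (∫ ξ, K (‖ξ‖, inner ℝ e ξ / ‖ξ‖)) := by
    calc (2 : ℝ) • ∫ ξ, (alphaD fun k => ξ k).mulVec (E ξ)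
        = ∫ ξ, ((alphaD fun k => ξ k).mulVec (E ξ) + (alphaD fun k => R ξ k).mulVec (E ξ)) := by
          rw [two_smul]
          nth_rewrite 2 [hIcomp]
          exact (integral_add (hIint (LinearIsometryEquiv.refl ℝ R3)) (hIint R)).symm
      _ = ∫ ξ, (2 : ℝ) • (alphaD fun k => e k).mulVec (K (‖ξ‖, inner ℝ e ξ / ‖ξ‖)) := by
          refine integral_congr_ae (ae_of_all _ fun ξ => ?_)
          simp only [hKE]
          exact alphaD_mulVec_add_reflection hx ξ (E ξ)
      _ = _ := by rw [integral_smul, hpull _ _ hKint']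
  have hinv : hwDirac t f x = ∫ ξ, (alphaD fun k => ξ k).mulVec (E ξ) := by
    rw [hwDirac, Real.fourierInv_eq]
    exact integral_congr_ae (ae_of_all _ hI)
  rw [hinv, smul_right_injective _ (two_ne_zero (α := ℝ)) hsum]
  congr 1
  have hmap := integral_map (μ := (volume : Measure R3)) hmp.measurable.aemeasurable
    (f := K) hKcont.aestronglyMeasurable
  rw [← hmap, hmp.map_eq, integral_prod_symm _ hKint]
  refine integral_congr_ae (ae_of_all _ fun μ => ?_)
  simp only [hK, waveProfile]
  exact integral_smul _ _

lemma waveProfile_apply (f : R3 → Spinor) (hint : Integrable (fourierProfile f) radialMeasure)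
    (s : ℝ) (j : Fin 4) :
    waveProfile f s j = 𝓕⁻ (fun ρ => (Set.Ioi (0 : ℝ)).indicator
      (fun ρ => (2 * π * ρ ^ 2) • fourierProfile f ρ j) ρ) s := by
  have hint' : Integrable (fun ρ => 𝐞 (ρ * s) • fourierProfile f ρ) radialMeasure := by
    refine hint.norm.mono' ?_ (ae_of_all _ fun ρ => by rw [Circle.norm_smul])
    have := continuous_fourierProfile f
    have hchar := Real.continuous_fourierChar
    exact Continuous.aestronglyMeasurable (by fun_prop)
  have h1 : waveProfile f s j = ∫ ρ, (𝐞 (ρ * s) • fourierProfile f ρ) j ∂radialMeasure :=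
    ((ContinuousLinearMap.proj (R := ℝ) (φ := fun _ : Fin 4 => ℂ) j).integral_comp_comm
      hint').symm
  rw [h1, radialMeasure, integral_withDensity_eq_integral_toReal_smul (by fun_prop)
    (ae_of_all _ fun _ => ENNReal.ofReal_lt_top), Real.fourierInv_eq,
    ← integral_indicator measurableSet_Ioi]
  refine integral_congr_ae (ae_of_all _ fun ρ => ?_)
  by_cases hρ : ρ ∈ Set.Ioi (0 : ℝ)
  · simp only [Set.indicator_of_mem hρ]
    rw [ENNReal.toReal_ofReal (by positivity)]
    simp [Circle.smul_def, mul_comm s]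
    ring
  · simp [Set.indicator_of_notMem hρ]

lemma integrable_profile_component (f : R3 → Spinor)
    (hint : Integrable (fourierProfile f) radialMeasure) (j : Fin 4) :
    Integrable fun ρ => (Set.Ioi (0 : ℝ)).indicator
      (fun ρ => (2 * π * ρ ^ 2) • fourierProfile f ρ j) ρ := by
  have h1 : Integrable (fun ρ => fourierProfile f ρ j) radialMeasure :=
    (ContinuousLinearMap.proj (R := ℝ) (φ := fun _ : Fin 4 => ℂ) j).integrable_comp hint
  rw [radialMeasure, integrable_withDensity_iff_integrable_smul' (by fun_prop)
    (ae_of_all _ fun _ => ENNReal.ofReal_lt_top)] at h1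
  rw [integrable_indicator_iff measurableSet_Ioi]
  refine h1.congr (ae_of_all _ fun ρ => ?_)
  simp only
  rw [ENNReal.toReal_ofReal (by positivity)]

lemma hSob_one_sq {f : R3 → Spinor} (hf : ∀ j, IsRadial fun x => f x j) :
    hSob 1 f ^ 2 = 2 * ∫⁻ ρ, ‖ρ‖ₑ ^ 2 * ‖fourierProfile f ρ‖ₑ ^ 2 ∂radialMeasure := by
  have hc := (continuous_fourierProfile f).enorm.measurable
  rw [← lintegral_comp_norm (g := fun ρ => ‖ρ‖ₑ ^ 2 * ‖fourierProfile f ρ‖ₑ ^ 2) (by fun_prop)]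
  have := eLpNorm_nnreal_pow_eq_lintegral (μ := (volume : Measure R3))
    (f := fun ξ : R3 => ‖ξ‖ ^ (1 : ℝ) • 𝓕 f ξ) (p := 2) (by norm_num)
  simpa [hSob, enorm_smul, mul_pow, fourier_eq_fourierProfile hf] using this

lemma lintegral_waveProfile_sq_le {f : R3 → Spinor} (hf : ∀ j, IsRadial fun x => f x j)
    (hint : Integrable (fourierProfile f) radialMeasure) :
    ∫⁻ s, ‖waveProfile f s‖ₑ ^ 2 ≤ ENNReal.ofReal (4 * π) * hSob 1 f ^ 2 := by
  have hc := (continuous_fourierProfile f).enorm.measurable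
  have hcomp : ∀ j : Fin 4, ∫⁻ s, ‖waveProfile f s j‖ₑ ^ 2 ≤
      ENNReal.ofReal (2 * π) * ∫⁻ ρ, ‖ρ‖ₑ ^ 2 * ‖fourierProfile f ρ‖ₑ ^ 2 ∂radialMeasure := by
    intro j
    simp only [waveProfile_apply f hint]
    refine (lintegral_fourierInv_sq_le (integrable_profile_component f hint j)).trans ?_
    rw [lintegral_radialMeasure (by fun_prop), ← lintegral_indicator measurableSet_Ioi,
      ← lintegral_const_mul' _ _ ENNReal.ofReal_ne_top]
    refine lintegral_mono fun ρ => ?_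
    by_cases hρ : ρ ∈ Set.Ioi (0 : ℝ)
    · simp only [Set.indicator_of_mem hρ]
      have hj : ‖fourierProfile f ρ j‖ₑ ≤ ‖fourierProfile f ρ‖ₑ :=
        enorm_le_iff_norm_le.2 (norm_le_pi_norm _ j)
      have hρ0 : (0 : ℝ) ≤ ρ := le_of_lt hρ
      rw [enorm_smul, mul_pow, Real.enorm_eq_ofReal (by positivity), Real.enorm_eq_ofReal hρ0]
      calc ENNReal.ofReal (2 * π * ρ ^ 2) ^ 2 * ‖fourierProfile f ρ j‖ₑ ^ 2
          ≤ ENNReal.ofReal (2 * π * ρ ^ 2) ^ 2 * ‖fourierProfile f ρ‖ₑ ^ 2 := by gcongr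
        _ = _ := by
          rw [ENNReal.ofReal_mul (by positivity), ENNReal.ofReal_pow hρ0]
          ring
    · simp [Set.indicator_of_notMem hρ]
  have hsup : ∀ v : Spinor, ‖v‖ₑ ^ 2 ≤ ∑ j, ‖v j‖ₑ ^ 2 := by
    intro v
    obtain ⟨j, hj⟩ : ∃ j, ‖v‖ = ‖v j‖ := by
      obtain ⟨j, -, hj⟩ := Finset.exists_mem_eq_sup Finset.univ Finset.univ_nonempty
        (fun j => ‖v j‖₊)
      exact ⟨j, by rw [Pi.norm_def, hj]; rfl⟩
    have hj' : ‖v‖ₑ = ‖v j‖ₑ := by rw [← ofReal_norm, ← ofReal_norm, hj]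
    rw [hj']
    exact Finset.single_le_sum (f := fun j => ‖v j‖ₑ ^ 2) (fun _ _ => zero_le) (Finset.mem_univ j)
  have hmeas : ∀ j : Fin 4, Measurable fun s => ‖waveProfile f s j‖ₑ ^ 2 := by
    intro j
    simp only [waveProfile_apply f hint, Real.fourierInv_eq_fourier_neg]
    have : Continuous (𝓕 fun ρ => (Set.Ioi (0 : ℝ)).indicator
        (fun ρ => (2 * π * ρ ^ 2) • fourierProfile f ρ j) ρ) :=
      VectorFourier.fourierIntegral_continuous Real.continuous_fourierChar (by fun_prop)
        (integrable_profile_component f hint j)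
    exact (this.comp continuous_neg).enorm.measurable.pow_const 2
  calc ∫⁻ s, ‖waveProfile f s‖ₑ ^ 2 ≤ ∫⁻ s, ∑ j, ‖waveProfile f s j‖ₑ ^ 2 :=
        lintegral_mono fun s => hsup _
    _ = ∑ j, ∫⁻ s, ‖waveProfile f s j‖ₑ ^ 2 := lintegral_finsetSum _ fun j _ => hmeas j
    _ ≤ ∑ _j : Fin 4, ENNReal.ofReal (2 * π) *
          ∫⁻ ρ, ‖ρ‖ₑ ^ 2 * ‖fourierProfile f ρ‖ₑ ^ 2 ∂radialMeasure :=
        Finset.sum_le_sum fun j _ => hcomp j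
    _ = ENNReal.ofReal (4 * π) * hSob 1 f ^ 2 := by
        rw [hSob_one_sq hf, show 4 * π = 2 * (2 * π) by ring, ENNReal.ofReal_mul two_pos.le]
        simp
        ring

lemma eLpNorm_hwDirac_le {f : R3 → Spinor} (hf : ∀ j, IsRadial fun x => f x j)
    (hint : Integrable (𝓕 f)) (t : ℝ) :
    eLpNorm (hwDirac t f) ⊤ volume ≤
      6 * dyadicMaximal (fun s => ‖waveProfile f s‖ₑ) (t / (2 * π)) := by
  rw [eLpNorm_exponent_top]
  refine eLpNormEssSup_le_of_ae_enorm_bound ?_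
  filter_upwards [Measure.ae_ne volume (0 : R3)] with x hx
  have hx' : 0 < ‖x‖ := norm_pos_iff.2 hx
  have hunit : ‖‖x‖⁻¹ • x‖ = 1 := by
    rw [norm_smul, norm_inv, norm_norm, inv_mul_cancel₀ hx'.ne']
  rw [hwDirac_eq hf hint t hx]
  set w := ∫ μ in Set.Ioo (-1 : ℝ) 1, μ • waveProfile f (t / (2 * π) + ‖x‖ * μ)
  calc ‖(alphaD fun k => (‖x‖⁻¹ • x) k).mulVec w‖ₑ ≤ 3 * ‖w‖ₑ := by
        have h := norm_alphaD_mulVec_le (‖x‖⁻¹ • x) w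
        rw [hunit, mul_one] at h
        rw [← ofReal_norm, ← ofReal_norm, show (3 : ℝ≥0∞) = ENNReal.ofReal 3 by simp,
          ← ENNReal.ofReal_mul (by norm_num)]
        exact ENNReal.ofReal_le_ofReal h
    _ ≤ 3 * ∫⁻ μ in Set.Ioo (-1 : ℝ) 1, ‖μ • waveProfile f (t / (2 * π) + ‖x‖ * μ)‖ₑ := by
        gcongr
        exact enorm_integral_le_lintegral_enorm _
    _ ≤ 3 * ∫⁻ μ in Set.Ioo (-1 : ℝ) 1, ‖waveProfile f (t / (2 * π) + ‖x‖ * μ)‖ₑ := by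
        refine mul_le_mul_right (setLIntegral_mono' measurableSet_Ioo fun μ hμ => ?_) _
        rw [enorm_smul]
        refine mul_le_of_le_one_left' ?_
        rw [← ofReal_norm, Real.norm_eq_abs, ← ENNReal.ofReal_one]
        exact ENNReal.ofReal_le_ofReal (abs_le.2 ⟨hμ.1.le, hμ.2.le⟩)
    _ ≤ 3 * ∫⁻ μ in Set.Icc (-1 : ℝ) 1, ‖waveProfile f (t / (2 * π) + ‖x‖ * μ)‖ₑ := by
        refine mul_le_mul_right (lintegral_mono_set Set.Ioo_subset_Icc_self) _
    _ ≤ 3 * (2 * dyadicMaximal (fun s => ‖waveProfile f s‖ₑ) (t / (2 * π))) := by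
        gcongr
        exact lintegral_comp_add_mul_le_dyadicMaximal (fun s => ‖waveProfile f s‖ₑ) _ hx'
    _ = 6 * dyadicMaximal (fun s => ‖waveProfile f s‖ₑ) (t / (2 * π)) := by
        rw [← mul_assoc]; norm_num

lemma hwDirac_eq_zero_of_not_integrable {f : R3 → Spinor} (h : ¬ Integrable (𝓕 f)) (t : ℝ) :
    hwDirac t f = 0 := by
  funext x
  rw [hwDirac, Real.fourierInv_eq]
  exact integral_undef fun h' => h (integrable_fourier_of_integrable t x h')

lemma continuous_waveProfile {f : R3 → Spinor}
    (hint : Integrable (fourierProfile f) radialMeasure) : Continuous (waveProfile f) := by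
  have := continuous_fourierProfile f
  have hchar := Real.continuous_fourierChar
  refine continuous_of_dominated (bound := fun ρ => ‖fourierProfile f ρ‖) (fun s => ?_)
    (fun s => ae_of_all _ fun ρ => by rw [Circle.norm_smul]) hint.norm (ae_of_all _ fun ρ => ?_)
  · exact Continuous.aestronglyMeasurable (by fun_prop)
  · fun_prop

lemma lintegral_eLpNorm_hwDirac_sq_le {f : R3 → Spinor} (hf : ∀ j, IsRadial fun x => f x j) :
    ∫⁻ t, eLpNorm (hwDirac t f) ⊤ volume ^ 2 ≤
      ENNReal.ofReal (46080 * π ^ 2) * hSob 1 f ^ 2 := by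
  by_cases hint : Integrable (𝓕 f)
  swap
  · simp [hwDirac_eq_zero_of_not_integrable hint]
  have hint' := integrable_fourierProfile hf hint
  set φ : ℝ → ℝ≥0∞ := fun s => ‖waveProfile f s‖ₑ
  have hφm : Measurable φ := (continuous_waveProfile hint').enorm.measurable
  have hbound : ∀ s, φ s ≤ (∫⁻ ρ, ‖fourierProfile f ρ‖ₑ ∂radialMeasure).toNNReal := by
    intro s
    rw [ENNReal.coe_toNNReal (ne_of_lt hint'.2)]
    refine (enorm_integral_le_lintegral_enorm _).trans (lintegral_mono fun ρ => ?_)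
    rw [← ofReal_norm, ← ofReal_norm, Circle.norm_smul]
  have h2π : (0 : ℝ) < 2 * π := by positivity
  calc ∫⁻ t, eLpNorm (hwDirac t f) ⊤ volume ^ 2
      ≤ ∫⁻ t, (6 * dyadicMaximal φ (t / (2 * π))) ^ 2 :=
        lintegral_mono fun t => pow_le_pow_left' (eLpNorm_hwDirac_le hf hint t) 2
    _ = 36 * ∫⁻ t, dyadicMaximal φ (t / (2 * π)) ^ 2 := by
        simp only [mul_pow]
        rw [lintegral_const_mul' _ _ (by norm_num)]
        norm_num
    _ = 36 * (ENNReal.ofReal (2 * π) * ∫⁻ s, dyadicMaximal φ s ^ 2) := by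
        congr 1
        have h := lintegral_image_eq_lintegral_abs_deriv_mul (f := fun s : ℝ => 2 * π * s)
          (f' := fun _ => 2 * π) (s := Set.univ) MeasurableSet.univ
          (fun x _ => by simpa using (hasDerivAt_id x).const_mul (2 * π))
          (fun x _ y _ hxy => mul_left_cancel₀ h2π.ne' hxy)
          (fun t => dyadicMaximal φ (t / (2 * π)) ^ 2)
        rw [Set.image_univ, (mul_left_surjective₀ h2π.ne').range_eq] at h
        simp only [Measure.restrict_univ, abs_of_pos h2π, mul_div_cancel_left₀ _ h2π.ne'] at h
        rw [h, lintegral_const_mul' _ _ ENNReal.ofReal_ne_top]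
    _ ≤ 36 * (ENNReal.ofReal (2 * π) * (160 * (ENNReal.ofReal (4 * π) * hSob 1 f ^ 2))) := by
        gcongr
        refine (lintegral_dyadicMaximal_sq_le hφm _ hbound).trans ?_
        gcongr
        exact lintegral_waveProfile_sq_le hf hint'
    _ = ENNReal.ofReal (46080 * π ^ 2) * hSob 1 f ^ 2 := by
        have hconst : ENNReal.ofReal (46080 * π ^ 2) =
            36 * (ENNReal.ofReal (2 * π) * (160 * ENNReal.ofReal (4 * π))) := by
          rw [show 46080 * π ^ 2 = 36 * ((2 * π) * (160 * (4 * π))) by ring,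
            ENNReal.ofReal_mul (by norm_num : (0 : ℝ) ≤ 36), ENNReal.ofReal_mul h2π.le,
            ENNReal.ofReal_mul (by norm_num : (0 : ℝ) ≤ 160), ENNReal.ofReal_ofNat,
            ENNReal.ofReal_ofNat]
        rw [hconst]
        ring

/-- Endpoint estimate for `e^{it|D|}|D|^{-1}𝒟` acting on componentwise
radial spinor fields on `ℝ³`. -/
theorem endpoint_strichartz_halfwave_dirac :
    ∃ C : ℝ≥0, ∀ f : R3 → Spinor, (∀ j, IsRadial fun x => f x j) →
      L2Linf (fun t => hwDirac t f) ≤ (C : ℝ≥0∞) * hSob 1 f := by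
  refine ⟨(Real.toNNReal (46080 * π ^ 2)) ^ (1 / 2 : ℝ), fun f hf => ?_⟩
  calc L2Linf (fun t => hwDirac t f)
      ≤ (ENNReal.ofReal (46080 * π ^ 2) * hSob 1 f ^ 2) ^ (1 / 2 : ℝ) :=
        ENNReal.rpow_le_rpow (lintegral_eLpNorm_hwDirac_sq_le hf) (by norm_num)
    _ = _ := by
        rw [ENNReal.mul_rpow_of_nonneg _ _ (by norm_num), ENNReal.coe_rpow_of_nonneg _
          (by norm_num), ENNReal.ofReal, ← ENNReal.rpow_natCast, ← ENNReal.rpow_mul]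
        norm_num
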